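/- (Floating-point spacing bound) Let x ∈ F with −maxF < x ≤ maxF. Then the set { y ∈ F : y < x } is nonempty, and its greatest element g (the floating-point predecessor of x) satisfies g ≥ x − |x|/ed − em; in particular both x and its predecessor lie in [D(x), U(x)]. -/

import Mathlib

noncomputable section

/-- The maximum exponent `e_max = 2^(eb-1) - 1`, as an integer. -/
def emax (eb : ℕ) : ℤ := 2 ^ (eb - 1) - 1

/-- The set of finite floating-point numbers
`F = { M · 2^(e - sb + 1) : M, e ∈ ℤ, |M| ≤ 2^sb - 1, 1 - e_max ≤ e ≤ e_max }`. -/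
def Fset (eb sb : ℕ) : Set ℝ :=
  {x | ∃ M e : ℤ, |M| ≤ 2 ^ sb - 1 ∧ 1 - emax eb ≤ e ∧ e ≤ emax eb ∧
    x = (M : ℝ) * (2 : ℝ) ^ (e - (sb : ℤ) + 1)}

/-- `ed = 2^(sb-1)`. -/
def edc (sb : ℕ) : ℝ := 2 ^ (sb - 1)

/-- `em = (ed - 1) / (2^(e_max - 1) · ed)`. -/
def emc (eb sb : ℕ) : ℝ := (edc sb - 1) / ((2 : ℝ) ^ (emax eb - 1) * edc sb)

/-- The largest finite floating-point number `maxF = (2^sb - 1) · 2^(e_max - sb + 1)`. -/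
def maxF (eb sb : ℕ) : ℝ := ((2 : ℝ) ^ sb - 1) * (2 : ℝ) ^ (emax eb - (sb : ℤ) + 1)

/-- The downward rounding approximation `D(x) = x - |x|/ed - em`. -/
def Dr (eb sb : ℕ) (x : ℝ) : ℝ := x - |x| / edc sb - emc eb sb

/-- The upward rounding approximation `U(x) = x + |x|/ed + em`. -/
def Ur (eb sb : ℕ) (x : ℝ) : ℝ := x + |x| / edc sb + emc eb sb

/-- `z` is a directed rounding of `x`: the greatest element of `F` below `x`
or the least element of `F` above `x`. -/
def DirRound (eb sb : ℕ) (x z : ℝ) : Prop :=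
  IsGreatest {y ∈ Fset eb sb | y ≤ x} z ∨ IsLeast {y ∈ Fset eb sb | x ≤ y} z

theorem Fset_finite (eb sb : ℕ) : (Fset eb sb).Finite := by
  have h : ((Set.Icc (-(2 ^ sb - 1) : ℤ) (2 ^ sb - 1)) ×ˢ
      (Set.Icc (1 - emax eb) (emax eb))).Finite :=
    (Set.finite_Icc _ _).prod (Set.finite_Icc _ _)
  refine (h.image (fun p : ℤ × ℤ => (p.1 : ℝ) * (2 : ℝ) ^ (p.2 - (sb : ℤ) + 1))).subset ?_
  rintro x ⟨M, e, hM, h1, h2, rfl⟩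
  exact ⟨(M, e), ⟨⟨(abs_le.mp hM).1, (abs_le.mp hM).2⟩, h1, h2⟩, rfl⟩

theorem edc_ge (sb : ℕ) (hsb : 2 ≤ sb) : 2 ≤ edc sb := by
  unfold edc
  calc (2 : ℝ) = 2 ^ 1 := by norm_num
    _ ≤ 2 ^ (sb - 1) := pow_le_pow_right₀ (by norm_num) (by omega)

theorem emc_ge (eb sb : ℕ) (hsb : 2 ≤ sb) :
    (2 : ℝ) ^ (1 - emax eb - (sb : ℤ) + 1) ≤ emc eb sb := by
  have h := edc_ge sb hsb
  have h2 : (2 : ℝ) ^ (1 - emax eb - (sb : ℤ) + 1) = 1 / ((2 : ℝ) ^ (emax eb - 1) * edc sb) := by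
    have : edc sb = (2 : ℝ) ^ ((sb : ℤ) - 1) := by
      unfold edc
      rw [← zpow_natCast]
      congr 1
      omega
    rw [this, ← zpow_add₀ (by norm_num), one_div, ← zpow_neg]
    congr 1
    ring
  rw [h2]
  unfold emc
  have : 0 < edc sb := by linarith
  gcongr
  linarith

theorem pred_exists (eb sb : ℕ) (hsb : 2 ≤ sb) (n : ℕ) : ∀ (M e : ℤ),
    e = 1 - emax eb + n → |M| ≤ 2 ^ sb - 1 → e ≤ emax eb →
    -maxF eb sb < (M : ℝ) * (2 : ℝ) ^ (e - (sb : ℤ) + 1) →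
    ∃ y ∈ Fset eb sb, y < (M : ℝ) * (2 : ℝ) ^ (e - (sb : ℤ) + 1) ∧
      (M : ℝ) * (2 : ℝ) ^ (e - (sb : ℤ) + 1)
        - |(M : ℝ) * (2 : ℝ) ^ (e - (sb : ℤ) + 1)| / edc sb - emc eb sb ≤ y := by
  have hed := edc_ge sb hsb
  have hem := emc_ge eb sb hsb
  have hpow : (2 : ℤ) ^ sb = 2 * 2 ^ (sb - 1) := by
    rw [← pow_succ']
    congr 1
    omega
  have key : ∀ (M e : ℤ), 1 - emax eb ≤ e → |M| ≤ 2 ^ sb - 1 → e ≤ emax eb →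
      -maxF eb sb < (M : ℝ) * (2 : ℝ) ^ (e - (sb : ℤ) + 1) →
      (2 : ℝ) ^ (e - (sb : ℤ) + 1) ≤
        |(M : ℝ) * (2 : ℝ) ^ (e - (sb : ℤ) + 1)| / edc sb + emc eb sb →
      ∃ y ∈ Fset eb sb, y < (M : ℝ) * (2 : ℝ) ^ (e - (sb : ℤ) + 1) ∧
      (M : ℝ) * (2 : ℝ) ^ (e - (sb : ℤ) + 1)
        - |(M : ℝ) * (2 : ℝ) ^ (e - (sb : ℤ) + 1)| / edc sb - emc eb sb ≤ y := by
    intro M e he hM he2 hx hq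
    have hq0 : (0 : ℝ) < (2 : ℝ) ^ (e - (sb : ℤ) + 1) := by positivity
    refine ⟨((M - 1 : ℤ) : ℝ) * (2 : ℝ) ^ (e - (sb : ℤ) + 1), ?_, ?_, ?_⟩
    · have hM' := abs_le.mp hM
      by_cases hc : M = -(2 ^ sb - 1)
      · have hne : e ≠ emax eb := by
          rintro rfl
          apply absurd hx
          rw [hc]
          unfold maxF
          push_cast
          linarith
        have hpos : (0 : ℤ) < 2 ^ (sb - 1) := by positivity
        refine ⟨-2 ^ (sb - 1), e + 1, ?_, by omega, by omega, ?_⟩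
        · rw [abs_neg, abs_of_pos hpos]
          omega
        · have h1 : M - 1 = -(2 * 2 ^ (sb - 1)) := by rw [hc, ← hpow]; ring
          rw [h1, show e + 1 - (sb : ℤ) + 1 = (e - (sb : ℤ) + 1) + 1 by ring,
            zpow_add_one₀ (by norm_num) (e - (sb : ℤ) + 1)]
          push_cast
          ring
      · refine ⟨M - 1, e, ?_, he, he2, rfl⟩
        rw [abs_le]
        constructor <;> omega
    · push_cast
      linarith
    · push_cast
      linarith
  induction n with
  | zero =>
    intro M e he hM he2 hx
    have he' : e = 1 - emax eb := by simpa using he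
    refine key M e he'.ge hM he2 hx ?_
    have : 0 ≤ |(M : ℝ) * (2 : ℝ) ^ (e - (sb : ℤ) + 1)| / edc sb := by positivity
    rw [he'] at this ⊢
    linarith
  | succ n ih =>
    intro M e he hM he2 hx
    push_cast at he
    by_cases hc : 2 ^ (sb - 1) ≤ |M|
    · refine key M e (by omega) hM he2 hx ?_
      have hq0 : (0 : ℝ) < (2 : ℝ) ^ (e - (sb : ℤ) + 1) := by positivity
      have h0 : (0 : ℝ) < (2 : ℝ) ^ (1 - emax eb - (sb : ℤ) + 1) := by positivity
      have hc' : edc sb ≤ |(M : ℝ)| := by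
        unfold edc
        exact_mod_cast hc
      have : (2 : ℝ) ^ (e - (sb : ℤ) + 1) ≤
          |(M : ℝ) * (2 : ℝ) ^ (e - (sb : ℤ) + 1)| / edc sb := by
        rw [le_div_iff₀ (by linarith), abs_mul, abs_of_pos hq0, mul_comm]
        gcongr
      linarith
    · have heq : (M : ℝ) * (2 : ℝ) ^ (e - (sb : ℤ) + 1) =
          ((2 * M : ℤ) : ℝ) * (2 : ℝ) ^ ((e - 1) - (sb : ℤ) + 1) := by
        rw [show e - (sb : ℤ) + 1 = ((e - 1) - (sb : ℤ) + 1) + 1 by ring,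
            zpow_add_one₀ (by norm_num)]
        push_cast
        ring
      rw [heq] at hx ⊢
      refine ih (2 * M) (e - 1) (by omega) ?_ (by omega) hx
      rw [abs_mul, abs_two]
      omega

theorem stmt9 (eb sb : ℕ) (heb : 2 ≤ eb) (hsb : 2 ≤ sb)
    (x : ℝ) (hxF : x ∈ Fset eb sb) (hx1 : -maxF eb sb < x) (hx2 : x ≤ maxF eb sb) :
    {y ∈ Fset eb sb | y < x}.Nonempty ∧
      ∃ g, IsGreatest {y ∈ Fset eb sb | y < x} g ∧
        x - |x| / edc sb - emc eb sb ≤ g ∧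
        (Dr eb sb x ≤ x ∧ x ≤ Ur eb sb x) ∧
        (Dr eb sb x ≤ g ∧ g ≤ Ur eb sb x) := by
  obtain ⟨M, e, hM, h1, h2, hx⟩ := id hxF
  have hed := edc_ge sb hsb
  have hem : 0 < emc eb sb := lt_of_lt_of_le (by positivity) (emc_ge eb sb hsb)
  obtain ⟨y, hyF, hyx, hy⟩ := pred_exists eb sb hsb (e - (1 - emax eb)).toNat M e
    (by omega) hM h2 (hx ▸ hx1)
  rw [← hx] at hyx hy
  have hne : {y ∈ Fset eb sb | y < x}.Nonempty := ⟨y, hyF, hyx⟩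
  have hfin : {y ∈ Fset eb sb | y < x}.Finite := (Fset_finite eb sb).subset (Set.sep_subset _ _)
  obtain ⟨g, hg⟩ := hfin.exists_maximal hne
  have hgg : IsGreatest {y ∈ Fset eb sb | y < x} g := by
    refine ⟨hg.1, fun z hz => ?_⟩
    rcases le_total z g with h | h
    · exact h
    · exact hg.2 hz h
  have hyg : y ≤ g := hgg.2 ⟨hyF, hyx⟩
  have hgx : g < x := hgg.1.2
  have hab : 0 ≤ |x| / edc sb := by positivity
  refine ⟨hne, g, hgg, by linarith, ⟨?_, ?_⟩, ?_, ?_⟩ <;> simp only [Dr, Ur] <;> linarith
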